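/- Let K ⊂ ℝⁿ be a convex body with dim K = n whose centroid is at the origin. Then vol(K ∩ (-K)) ≥ 2^{-n} · vol(K). -/

import Mathlib

open MeasureTheory Pointwise
open scoped ENNReal

/-- The measure `μ` satisfies the Prékopa–Leindler inequality with weights `a` and `b`. -/
def SatisfiesPrekopaLeindler {E : Type*} [AddCommGroup E] [Module ℝ E] [MeasurableSpace E]
    (μ : Measure E) (a b : ℝ) : Prop :=
  ∀ f g h : E → ℝ≥0∞, Measurable f → Measurable g → Measurable h →
    (∀ x y, f x ^ a * g y ^ b ≤ h (a • x + b • y)) →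
    (∫⁻ x, f x ∂μ) ^ a * (∫⁻ x, g x ∂μ) ^ b ≤ ∫⁻ x, h x ∂μ

theorem ENNReal.geom_mean_le_arith_mean_weighted {a b : ℝ} (ha : 0 < a) (hb : 0 < b)
    (hab : a + b = 1) (x y : ℝ≥0∞) :
    x ^ a * y ^ b ≤ ENNReal.ofReal a * x + ENNReal.ofReal b * y := by
  have hpq : (a⁻¹).HolderConjugate b⁻¹ :=
    ⟨by simpa using hab, by positivity, by positivity⟩
  have h := ENNReal.young_inequality (x ^ a) (y ^ b) hpq
  rwa [← ENNReal.rpow_mul, ← ENNReal.rpow_mul, mul_inv_cancel₀ ha.ne', mul_inv_cancel₀ hb.ne',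
    ENNReal.rpow_one, ENNReal.rpow_one, ENNReal.ofReal_inv_of_pos ha,
    ENNReal.ofReal_inv_of_pos hb, div_eq_mul_inv, div_eq_mul_inv, inv_inv, inv_inv, mul_comm x,
    mul_comm y] at h

theorem Real.volume_image_mul_add {a : ℝ} (ha : 0 < a) (c : ℝ) (s : Set ℝ) :
    volume ((fun x => a * x + c) '' s) = ENNReal.ofReal a * volume s := by
  have : (fun x => a * x + c) '' s = (fun x => x + c) '' (a • s) := by
    rw [← Set.image_smul, Set.image_image]; rfl
  rw [this, Set.image_add_right, measure_preimage_add_right, Measure.addHaar_smul]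
  simp [abs_of_pos ha]

theorem Real.add_volume_le_of_isCompact {a b : ℝ} (ha : 0 < a) (hb : 0 < b) {A B C : Set ℝ}
    (hA : IsCompact A) (hB : IsCompact B) (hA' : A.Nonempty) (hB' : B.Nonempty)
    (hC : ∀ x ∈ A, ∀ y ∈ B, a * x + b * y ∈ C) :
    ENNReal.ofReal a * volume A + ENNReal.ofReal b * volume B ≤ volume C := by
  obtain ⟨p, hpA, hp⟩ := hA.exists_isGreatest hA'
  obtain ⟨q, hqB, hq⟩ := hB.exists_isLeast hB'
  rw [← Real.volume_image_mul_add ha (b * q), ← Real.volume_image_mul_add hb (a * p)]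
  have hmeas : MeasurableSet ((fun x => b * x + a * p) '' B) :=
    (hB.image (by fun_prop)).measurableSet
  rw [← measure_union₀ hmeas.nullMeasurableSet]
  · apply measure_mono
    rintro _ (⟨x, hx, rfl⟩ | ⟨y, hy, rfl⟩)
    · exact hC x hx q hqB
    · simpa only [add_comm] using hC p hpA y hy
  · refine measure_mono_null (t := {a * p + b * q}) ?_ (by simp)
    rintro _ ⟨⟨x, hx, rfl⟩, ⟨y, hy, hxy⟩⟩
    have h1 : a * x ≤ a * p := by have := hp hx; gcongr
    have h2 : b * q ≤ b * y := by have := hq hy; gcongr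
    simp only [Set.mem_singleton_iff] at hxy ⊢
    linarith

theorem Real.add_volume_le {a b : ℝ} (ha : 0 < a) (hb : 0 < b) {A B C : Set ℝ}
    (hA : MeasurableSet A) (hB : MeasurableSet B) (hA' : A.Nonempty) (hB' : B.Nonempty)
    (hC : ∀ x ∈ A, ∀ y ∈ B, a * x + b * y ∈ C) :
    ENNReal.ofReal a * volume A + ENNReal.ofReal b * volume B ≤ volume C := by
  obtain ⟨p, hp⟩ := hA'
  obtain ⟨q, hq⟩ := hB'
  have key : ∀ S ⊆ A, IsCompact S → ∀ T ⊆ B, IsCompact T →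
      ENNReal.ofReal a * volume S + ENNReal.ofReal b * volume T ≤ volume C := by
    intro S hSA hS T hTB hT
    refine le_trans ?_ (Real.add_volume_le_of_isCompact ha hb (hS.insert p) (hT.insert q)
      ⟨p, by simp⟩ ⟨q, by simp⟩ (C := C) ?_)
    · gcongr <;> exact Set.subset_insert _ _
    · exact fun x hx y hy => hC x (Set.insert_subset hp hSA hx) y (Set.insert_subset hq hTB hy)
  rw [hA.measure_eq_iSup_isCompact, hB.measure_eq_iSup_isCompact]
  simp only [ENNReal.mul_iSup]
  simp only [iSup_and']
  have : Nonempty {S : Set ℝ // S ⊆ A ∧ IsCompact S} := ⟨⟨∅, by simp⟩⟩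
  have : Nonempty {S : Set ℝ // S ⊆ B ∧ IsCompact S} := ⟨⟨∅, by simp⟩⟩
  rw [← iSup_subtype (p := fun S => S ⊆ A ∧ IsCompact S)
    (f := fun S => ENNReal.ofReal a * volume (S : Set ℝ)),
    ← iSup_subtype (p := fun S => S ⊆ B ∧ IsCompact S)
    (f := fun S => ENNReal.ofReal b * volume (S : Set ℝ))]
  exact ENNReal.iSup_add_iSup_le fun S T => key S S.2.1 S.2.2 T T.2.1 T.2.2

theorem lintegral_eq_lintegral_Ioo_meas_lt {f : ℝ → ℝ≥0∞} (hf : Measurable f)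
    (hf1 : ∀ x, f x ≤ 1) :
    ∫⁻ x, f x = ∫⁻ t in Set.Ioo (0 : ℝ) 1, volume {x | ENNReal.ofReal t < f x} := by
  have hfin : ∀ x, f x ≠ ∞ := fun x => ne_top_of_le_ne_top ENNReal.one_ne_top (hf1 x)
  have h := lintegral_eq_lintegral_meas_lt volume (f := fun x => (f x).toReal)
    (Filter.Eventually.of_forall fun x => ENNReal.toReal_nonneg) hf.ennreal_toReal.aemeasurable
  simp only [ENNReal.ofReal_toReal (hfin _)] at h
  rw [h, ← Set.Ioo_union_Ici_eq_Ioi (zero_lt_one' ℝ),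
    lintegral_union measurableSet_Ici (Set.disjoint_left.2 fun x hx hx' =>
      absurd hx.2 (not_lt.2 hx'))]
  have h2 : ∫⁻ t in Set.Ici (1 : ℝ), volume {x | t < (f x).toReal} = 0 := by
    rw [setLIntegral_congr_fun (g := fun _ => 0) measurableSet_Ici]
    · simp
    · intro t ht
      have : {x | t < (f x).toReal} = ∅ := by
        ext x
        have := ENNReal.toReal_mono ENNReal.one_ne_top (hf1 x)
        simp only [Set.mem_Ici] at ht
        simp at this ⊢
        linarith
      simp [this]
  rw [h2, add_zero]
  refine setLIntegral_congr_fun measurableSet_Ioo fun t ht => ?_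
  congr 1
  ext x
  exact (ENNReal.ofReal_lt_iff_lt_toReal ht.1.le (hfin x)).symm

theorem Real.add_lintegral_le_of_iSup_eq_one {a b : ℝ} (ha : 0 < a) (hb : 0 < b)
    {f g h : ℝ → ℝ≥0∞} (hf : Measurable f) (hg : Measurable g) (hh : Measurable h)
    (hf1 : ⨆ x, f x = 1) (hg1 : ⨆ x, g x = 1)
    (H : ∀ x y t, t < f x → t < g y → t < h (a * x + b * y)) :
    ENNReal.ofReal a * (∫⁻ x, f x) + ENNReal.ofReal b * (∫⁻ x, g x) ≤ ∫⁻ x, h x := by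
  have hf1' : ∀ x, f x ≤ 1 := fun x => hf1 ▸ le_iSup f x
  have hg1' : ∀ x, g x ≤ 1 := fun x => hg1 ▸ le_iSup g x
  refine le_trans ?_ (lintegral_mono (f := fun x => min (h x) 1) fun x => min_le_left _ _)
  rw [lintegral_eq_lintegral_Ioo_meas_lt hf hf1', lintegral_eq_lintegral_Ioo_meas_lt hg hg1',
    lintegral_eq_lintegral_Ioo_meas_lt (hh.min measurable_const) fun x => min_le_right _ _]
  have hanti : ∀ k : ℝ → ℝ≥0∞, Measurable fun t : ℝ => volume {x | ENNReal.ofReal t < k x} :=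
    fun k => Antitone.measurable fun s t hst => measure_mono fun x hx =>
      lt_of_le_of_lt (ENNReal.ofReal_le_ofReal hst) hx
  rw [← lintegral_const_mul _ (hanti f), ← lintegral_const_mul _ (hanti g),
    ← lintegral_add_left ((hanti f).const_mul _)]
  refine setLIntegral_mono' measurableSet_Ioo fun t ht => ?_
  have ht1 : ENNReal.ofReal t < 1 := by simpa using ht.2
  refine Real.add_volume_le ha hb (measurableSet_lt measurable_const hf)
    (measurableSet_lt measurable_const hg) ?_ ?_ ?_
  · exact lt_iSup_iff.1 (hf1 ▸ ht1)
  · exact lt_iSup_iff.1 (hg1 ▸ ht1)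
  · exact fun x hx y hy => lt_min (H x y _ hx hy) ht1

theorem Real.prekopaLeindler_of_bounded {a b : ℝ} (ha : 0 < a) (hb : 0 < b) (hab : a + b = 1)
    {f g h : ℝ → ℝ≥0∞} (hf : Measurable f) (hg : Measurable g) (hh : Measurable h)
    (hf1 : ⨆ x, f x ≠ ∞) (hg1 : ⨆ x, g x ≠ ∞)
    (H : ∀ x y, f x ^ a * g y ^ b ≤ h (a • x + b • y)) :
    (∫⁻ x, f x) ^ a * (∫⁻ x, g x) ^ b ≤ ∫⁻ x, h x := by
  set A := ⨆ x, f x with hA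
  set B := ⨆ x, g x with hB
  by_cases hA0 : A = 0
  · have : ∀ x, f x = 0 := fun x => le_antisymm (hA0 ▸ le_iSup f x) zero_le
    simp [this, ha]
  by_cases hB0 : B = 0
  · have : ∀ x, g x = 0 := fun x => le_antisymm (hB0 ▸ le_iSup g x) zero_le
    simp [this, hb]
  have hc0 : A ^ a * B ^ b ≠ 0 := by simp [hA0, hB0, hf1, hg1]
  have hct : A ^ a * B ^ b ≠ ∞ :=
    ENNReal.mul_ne_top (ENNReal.rpow_ne_top_of_nonneg ha.le hf1)
      (ENNReal.rpow_ne_top_of_nonneg hb.le hg1)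
  have hinv : (A ^ a * B ^ b)⁻¹ = A⁻¹ ^ a * B⁻¹ ^ b := by
    rw [ENNReal.mul_inv (by simp [hA0, hf1]) (by simp [hB0, hg1]), ENNReal.inv_rpow,
      ENNReal.inv_rpow]
  have key := Real.add_lintegral_le_of_iSup_eq_one ha hb
    (f := fun x => A⁻¹ * f x) (g := fun x => B⁻¹ * g x) (h := fun x => (A ^ a * B ^ b)⁻¹ * h x)
    (hf.const_mul _) (hg.const_mul _) (hh.const_mul _)
    (by rw [← ENNReal.mul_iSup, ← hA, ENNReal.inv_mul_cancel hA0 hf1])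
    (by rw [← ENNReal.mul_iSup, ← hB, ENNReal.inv_mul_cancel hB0 hg1])
    (by
      intro x y t hx hy
      calc t = t ^ a * t ^ b := by
            rw [← ENNReal.rpow_add_of_nonneg _ _ ha.le hb.le, hab, ENNReal.rpow_one]
        _ < (A⁻¹ * f x) ^ a * (B⁻¹ * g y) ^ b :=
            ENNReal.mul_lt_mul (ENNReal.rpow_lt_rpow hx ha) (ENNReal.rpow_lt_rpow hy hb)
        _ = (A ^ a * B ^ b)⁻¹ * (f x ^ a * g y ^ b) := by
            rw [hinv, ENNReal.mul_rpow_of_nonneg _ _ ha.le, ENNReal.mul_rpow_of_nonneg _ _ hb.le]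
            ring
        _ ≤ _ := mul_le_mul_right (H x y) _)
  replace key := (ENNReal.geom_mean_le_arith_mean_weighted ha hb hab _ _).trans key
  rw [lintegral_const_mul _ hf, lintegral_const_mul _ hg, lintegral_const_mul _ hh,
    ENNReal.mul_rpow_of_nonneg _ _ ha.le, ENNReal.mul_rpow_of_nonneg _ _ hb.le,
    mul_mul_mul_comm, ← hinv] at key
  exact (ENNReal.mul_le_mul_iff_right (ENNReal.inv_ne_zero.2 hct) (ENNReal.inv_ne_top.2 hc0)).1 key

theorem iSup_min_natCast (x : ℝ≥0∞) : ⨆ n : ℕ, min x n = x := by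
  rw [← inf_iSup_eq, ENNReal.iSup_natCast]; simp

theorem Real.satisfiesPrekopaLeindler {a b : ℝ} (ha : 0 < a) (hb : 0 < b) (hab : a + b = 1) :
    SatisfiesPrekopaLeindler (volume : Measure ℝ) a b := by
  intro f g h hf hg hh H
  have hlim : ∀ k : ℝ → ℝ≥0∞, Measurable k →
      ∫⁻ x, k x = ⨆ n : ℕ, ∫⁻ x, min (k x) n := by
    intro k hk
    rw [← lintegral_iSup (fun n => hk.min measurable_const)]
    · simp only [iSup_min_natCast]
    · exact fun m n hmn x => min_le_min_left _ (by exact_mod_cast hmn)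
  have hpow : ∀ {c : ℝ}, 0 < c → ∀ u : ℕ → ℝ≥0∞, (⨆ n, u n) ^ c = ⨆ n, u n ^ c :=
    fun hc u => (ENNReal.orderIsoRpow _ hc).map_iSup u
  rw [hlim f hf, hlim g hg, hpow ha, hpow hb, ENNReal.iSup_mul]
  refine iSup_le fun m => ?_
  rw [ENNReal.mul_iSup]
  refine iSup_le fun n => ?_
  refine Real.prekopaLeindler_of_bounded ha hb hab (hf.min measurable_const)
    (hg.min measurable_const) hh ?_ ?_ fun x y => le_trans ?_ (H x y)
  · exact ne_top_of_le_ne_top (ENNReal.natCast_ne_top m) (iSup_le fun x => min_le_right _ _)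
  · exact ne_top_of_le_ne_top (ENNReal.natCast_ne_top n) (iSup_le fun x => min_le_right _ _)
  · gcongr <;> exact min_le_left _ _

theorem SatisfiesPrekopaLeindler.prod {E F : Type*} [AddCommGroup E] [Module ℝ E]
    [MeasurableSpace E] [AddCommGroup F] [Module ℝ F] [MeasurableSpace F]
    {μ : Measure E} {ν : Measure F} [SFinite ν] {a b : ℝ}
    (hμ : SatisfiesPrekopaLeindler μ a b) (hν : SatisfiesPrekopaLeindler ν a b) :
    SatisfiesPrekopaLeindler (μ.prod ν) a b := by
  intro f g h hf hg hh H
  rw [lintegral_prod f hf.aemeasurable, lintegral_prod g hg.aemeasurable,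
    lintegral_prod h hh.aemeasurable]
  refine hμ _ _ _ hf.lintegral_prod_right' hg.lintegral_prod_right' hh.lintegral_prod_right'
    fun s t => ?_
  exact hν _ _ _ (hf.comp measurable_prodMk_left) (hg.comp measurable_prodMk_left)
    (hh.comp measurable_prodMk_left) fun x y => H (s, x) (t, y)

theorem SatisfiesPrekopaLeindler.of_measurePreserving {E F : Type*} [AddCommGroup E] [Module ℝ E]
    [MeasurableSpace E] [AddCommGroup F] [Module ℝ F] [MeasurableSpace F]
    {μ : Measure E} {ν : Measure F} {a b : ℝ} (hμ : SatisfiesPrekopaLeindler μ a b)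
    {e : E → F} (he : MeasurePreserving e μ ν)
    (hlin : ∀ x y, e (a • x + b • y) = a • e x + b • e y) :
    SatisfiesPrekopaLeindler ν a b := by
  intro f g h hf hg hh H
  rw [← he.lintegral_comp hf, ← he.lintegral_comp hg, ← he.lintegral_comp hh]
  exact hμ _ _ _ (hf.comp he.measurable) (hg.comp he.measurable) (hh.comp he.measurable)
    fun x y => by simpa only [hlin] using H (e x) (e y)

theorem satisfiesPrekopaLeindler_pi {a b : ℝ} (ha : 0 < a) (hb : 0 < b) (hab : a + b = 1)
    (n : ℕ) : SatisfiesPrekopaLeindler (volume : Measure (Fin n → ℝ)) a b := by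
  induction n with
  | zero =>
    intro f g h hf hg hh H
    have : volume (Set.univ : Set (Fin 0 → ℝ)) = 1 := by simp [volume_pi]
    simp only [lintegral_unique, this, mul_one]
    convert H default default
  | succ n ih =>
    have he := (volume_preserving_piFinSuccAbove (fun _ : Fin (n + 1) => ℝ) 0).symm
    refine ((Real.satisfiesPrekopaLeindler ha hb hab).prod ih).of_measurePreserving he ?_
    rintro ⟨s, x⟩ ⟨t, y⟩
    ext i
    refine Fin.cases ?_ (fun i => ?_) i <;> simp [MeasurableEquiv.piFinSuccAbove]

section Covariogram

variable {E : Type*} [NormedAddCommGroup E]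

theorem isCompact_setOf_mem_and_sub_mem {K : Set E} (hK : IsCompact K) (z : E) :
    IsCompact {y | y ∈ K ∧ z - y ∈ K} :=
  hK.inter_right (hK.isClosed.preimage (by fun_prop : Continuous fun y => z - y))

variable [MeasurableSpace E] {μ : Measure E} {K : Set E}

/-- The measure of `K ∩ (z - K)`, that is, the density of the convolution of the restriction of `μ`
to `K` with itself. -/
noncomputable def sumDensity (μ : Measure E) (K : Set E) (z : E) : ℝ :=
  μ.real {y | y ∈ K ∧ z - y ∈ K}

theorem sumDensity_nonneg (z : E) : 0 ≤ sumDensity μ K z := measureReal_nonneg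

theorem sumDensity_zero : sumDensity μ K 0 = μ.real (K ∩ -K) := by
  simp [sumDensity, Set.inter_def]

variable [NormedSpace ℝ E]

theorem Convex.sumDensity_eq_zero (hK : Convex ℝ K) {z : E} (hz : z ∉ (2 : ℝ) • K) :
    sumDensity μ K z = 0 := by
  have : {y | y ∈ K ∧ z - y ∈ K} = ∅ := by
    refine Set.eq_empty_of_forall_notMem fun y hy => hz ?_
    refine ⟨(1 / 2 : ℝ) • y + (1 / 2 : ℝ) • (z - y),
      hK hy.1 hy.2 (by norm_num) (by norm_num) (by norm_num), ?_⟩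
    module
  simp [sumDensity, this]

theorem exists_ball_le_sumDensity [FiniteDimensional ℝ E] [μ.IsAddHaarMeasure]
    (hKc : IsCompact K) (h0 : (0 : E) ∈ interior K) :
    ∃ r > 0, ∃ v > 0, ∀ z ∈ Metric.ball (0 : E) r, v ≤ sumDensity μ K z := by
  obtain ⟨r, hr, hrK⟩ := Metric.mem_nhds_iff.1 (mem_interior_iff_mem_nhds.1 h0)
  refine ⟨r / 2, by positivity, μ.real (Metric.ball (0 : E) (r / 2)), ?_, fun z hz => ?_⟩
  · exact ENNReal.toReal_pos (Metric.measure_ball_pos μ _ (by positivity)).ne'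
      measure_ball_lt_top.ne
  · refine measureReal_mono (fun y hy => ?_)
      (isCompact_setOf_mem_and_sub_mem hKc z).measure_lt_top.ne
    rw [mem_ball_zero_iff] at hz hy
    refine ⟨hrK ?_, hrK ?_⟩ <;> rw [mem_ball_zero_iff]
    · linarith
    · linarith [norm_sub_le z y]

variable [BorelSpace E]

theorem Convex.sumDensity_rpow_mul_le (hK : Convex ℝ K) (hKc : IsCompact K) {a b : ℝ} (ha : 0 < a)
    (hb : 0 < b) (hab : a + b = 1) [IsFiniteMeasureOnCompacts μ]
    (hμ : SatisfiesPrekopaLeindler μ a b) (z w : E) :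
    sumDensity μ K z ^ a * sumDensity μ K w ^ b ≤ sumDensity μ K (a • z + b • w) := by
  have hm : ∀ z, MeasurableSet {y | y ∈ K ∧ z - y ∈ K} := fun z =>
    (isCompact_setOf_mem_and_sub_mem hKc z).measurableSet
  have key := hμ ({y | y ∈ K ∧ z - y ∈ K}.indicator 1) ({y | y ∈ K ∧ w - y ∈ K}.indicator 1)
    ({y | y ∈ K ∧ a • z + b • w - y ∈ K}.indicator 1) (measurable_one.indicator (hm _))
    (measurable_one.indicator (hm _)) (measurable_one.indicator (hm _)) (by
      intro x y
      by_cases hx : x ∈ {y | y ∈ K ∧ z - y ∈ K}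
      · by_cases hy : y ∈ {y | y ∈ K ∧ w - y ∈ K}
        · have hxy : a • x + b • y ∈ {y | y ∈ K ∧ a • z + b • w - y ∈ K} := by
            refine ⟨hK hx.1 hy.1 ha.le hb.le hab, ?_⟩
            convert hK hx.2 hy.2 ha.le hb.le hab using 1
            module
          simp [hx, hy, hxy]
        · simp [hy, hb]
      · simp [hx, ha])
  simp only [lintegral_indicator_one (hm _)] at key
  have := ENNReal.toReal_mono (isCompact_setOf_mem_and_sub_mem hKc _).measure_lt_top.ne key
  rwa [ENNReal.toReal_mul, ← ENNReal.toReal_rpow, ← ENNReal.toReal_rpow] at this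

variable [FiniteDimensional ℝ E]

theorem integrable_sumDensity_mul_and_integral_eq [μ.IsAddHaarMeasure] (hK : IsCompact K)
    {g : E → ℝ} (hg : Continuous g) :
    Integrable (fun z => sumDensity μ K z * g z) μ ∧
      ∫ z, sumDensity μ K z * g z ∂μ = ∫ x in K, ∫ y in K, g (x + y) ∂μ ∂μ := by
  set S : Set (E × E) := {p | p.2 ∈ K ∧ p.1 - p.2 ∈ K} with hS
  let e : E × E → E × E := fun p => (p.1 + p.2, p.2)
  have hec : Continuous e := by fun_prop
  have hinj : Function.Injective e := by
    rintro ⟨x, y⟩ ⟨x', y'⟩ h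
    simp only [e, Prod.mk.injEq] at h
    obtain ⟨h1, rfl⟩ := h
    simpa using h1
  have hpre : e ⁻¹' S = K ×ˢ K := by
    ext ⟨x, y⟩
    simp [e, hS, and_comm]
  have himg : e '' (K ×ˢ K) = S := by
    rw [← hpre, Set.image_preimage_eq_iff]
    rintro ⟨z, y⟩ -
    exact ⟨(z - y, y), by simp [e]⟩
  have hScomp : IsCompact S := himg ▸ (hK.prod hK).image hec
  have hSm : MeasurableSet S := hScomp.measurableSet
  have hint : IntegrableOn (fun p : E × E => g p.1) S (μ.prod μ) :=
    (hg.comp continuous_fst).continuousOn.integrableOn_compact hScomp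
  have hint' : Integrable (S.indicator fun p : E × E => g p.1) (μ.prod μ) :=
    (integrable_indicator_iff hSm).2 hint
  have hsec : ∀ z, ∫ y, S.indicator (fun p : E × E => g p.1) (z, y) ∂μ
      = sumDensity μ K z * g z := by
    intro z
    have : (fun y => S.indicator (fun p : E × E => g p.1) (z, y))
        = {y | y ∈ K ∧ z - y ∈ K}.indicator fun _ => g z :=
      funext fun _ => (Set.indicator_comp_right (Prod.mk z)).symm
    rw [this, integral_indicator_const _ (isCompact_setOf_mem_and_sub_mem hK z).measurableSet,
      sumDensity, smul_eq_mul]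
  constructor
  · simpa only [hsec] using hint'.integral_prod_left
  · simp only [← hsec]
    rw [← integral_prod _ hint', integral_indicator hSm,
      ← (measurePreserving_add_prod μ μ).setIntegral_preimage_emb
        (hec.measurableEmbedding hinj)]
    change ∫ p in e ⁻¹' S, g (p.1 + p.2) ∂μ.prod μ = _
    rw [hpre, setIntegral_prod]
    exact (hg.comp (continuous_fst.add continuous_snd)).continuousOn.integrableOn_compact
      (hK.prod hK)

theorem integrable_sumDensity [μ.IsAddHaarMeasure] (hK : IsCompact K) :
    Integrable (sumDensity μ K) μ := by
  simpa using (integrable_sumDensity_mul_and_integral_eq (μ := μ) hK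
    (continuous_const (y := (1 : ℝ)))).1

theorem integral_sumDensity [μ.IsAddHaarMeasure] (hK : IsCompact K) :
    ∫ z, sumDensity μ K z ∂μ = μ.real K ^ 2 := by
  simpa [sq] using (integrable_sumDensity_mul_and_integral_eq (μ := μ) hK
    (continuous_const (y := (1 : ℝ)))).2

theorem integral_sumDensity_mul_clm [μ.IsAddHaarMeasure] (hK : IsCompact K)
    (hcent : ∫ x in K, x ∂μ = 0) (L : E →L[ℝ] ℝ) :
    ∫ z, sumDensity μ K z * L z ∂μ = 0 := by
  have hid : IntegrableOn (fun x : E => x) K μ := continuous_id.continuousOn.integrableOn_compact hK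
  have hL : IntegrableOn (fun x => L x) K μ := L.integrable_comp hid
  have hL0 : ∫ x in K, L x ∂μ = 0 := by rw [L.integral_comp_comm hid, hcent, map_zero]
  have hc : ∀ c : ℝ, IntegrableOn (fun _ => c) K μ := fun c =>
    integrableOn_const hK.measure_lt_top.ne
  rw [(integrable_sumDensity_mul_and_integral_eq hK L.continuous).2]
  have : ∀ x, ∫ y in K, L (x + y) ∂μ = μ.real K * L x := by
    intro x
    simp only [map_add]
    rw [integral_add (hc _) hL, hL0]
    simp
  simp only [this]
  rw [integral_const_mul, hL0, mul_zero]

theorem Convex.zero_mem_interior_of_setIntegral_eq_zero [μ.IsAddHaarMeasure] (hK : Convex ℝ K)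
    (hKc : IsCompact K) (hint : (interior K).Nonempty) (hcent : ∫ x in K, x ∂μ = 0) :
    (0 : E) ∈ interior K := by
  by_contra h0
  obtain ⟨L, hL⟩ := geometric_hahn_banach_open_point hK.interior isOpen_interior h0
  simp only [map_zero] at hL
  have hL' : ∀ x ∈ K, L x ≤ 0 := by
    have h1 : K ⊆ closure (interior K) := by
      rw [hK.closure_interior_eq_closure_of_nonempty_interior hint]; exact subset_closure
    exact fun x hx => closure_minimal (fun y hy => (hL y hy).le)
      (isClosed_le L.continuous continuous_const) (h1 hx)
  have hid : IntegrableOn (fun x : E => x) K μ := continuous_id.continuousOn.integrableOn_compact hKc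
  have hLi : IntegrableOn (fun x => -L x) K μ := (L.integrable_comp hid).neg
  have hL0 : ∫ x in K, -L x ∂μ = 0 := by
    rw [integral_neg, L.integral_comp_comm hid, hcent, map_zero, neg_zero]
  have hpos := (setIntegral_pos_iff_support_of_nonneg_ae
    (ae_restrict_of_forall_mem hKc.measurableSet fun x hx => neg_nonneg.2 (hL' x hx)) hLi).2
    ((isOpen_interior.measure_pos μ hint).trans_le (measure_mono fun x hx =>
      ⟨by simpa using (hL x hx).ne, interior_subset hx⟩))
  exact hpos.ne' hL0

theorem exists_log_sumDensity_le [μ.IsAddHaarMeasure] (hK : Convex ℝ K) (hKc : IsCompact K)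
    (h0 : (0 : E) ∈ interior K)
    (hμ : ∀ a b : ℝ, 0 < a → 0 < b → a + b = 1 → SatisfiesPrekopaLeindler μ a b) :
    ∃ L : E →L[ℝ] ℝ, ∀ z, 0 < sumDensity μ K z →
      Real.log (sumDensity μ K z) ≤ Real.log (sumDensity μ K 0) + L z := by
  obtain ⟨r, hr, v, hv, hball⟩ := exists_ball_le_sumDensity (μ := μ) hKc h0
  set φ : E → ℝ := fun z => Real.log (sumDensity μ K z) with hφ
  set A : Set (E × ℝ) := {p | 0 < sumDensity μ K p.1 ∧ p.2 < φ p.1} with hA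
  have hAconv : Convex ℝ A := by
    rw [convex_iff_forall_pos]
    rintro ⟨z, s⟩ ⟨hz, hs⟩ ⟨w, t⟩ ⟨hw, ht⟩ a b ha hb hab
    have h := hK.sumDensity_rpow_mul_le hKc ha hb hab (hμ a b ha hb hab) z w
    have hp : 0 < sumDensity μ K z ^ a * sumDensity μ K w ^ b :=
      mul_pos (Real.rpow_pos_of_pos hz a) (Real.rpow_pos_of_pos hw b)
    refine ⟨hp.trans_le h, ?_⟩
    have h2 := Real.log_le_log hp h
    rw [Real.log_mul (Real.rpow_pos_of_pos hz a).ne' (Real.rpow_pos_of_pos hw b).ne',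
      Real.log_rpow hz, Real.log_rpow hw] at h2
    refine lt_of_lt_of_le ?_ h2
    exact add_lt_add (mul_lt_mul_of_pos_left hs ha) (mul_lt_mul_of_pos_left ht hb)
  have hsub : Metric.ball (0 : E) r ×ˢ Set.Iio (Real.log v) ⊆ interior A := by
    refine interior_maximal ?_ (Metric.isOpen_ball.prod isOpen_Iio)
    rintro ⟨z, t⟩ ⟨hz, ht⟩
    exact ⟨hv.trans_le (hball z hz), lt_of_lt_of_le ht (Real.log_le_log hv (hball z hz))⟩
  have hint : ∀ t < Real.log v, ((0 : E), t) ∈ interior A := fun t ht =>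
    hsub ⟨Metric.mem_ball_self hr, ht⟩
  have hnot : ((0 : E), φ 0) ∉ interior A := fun h => lt_irrefl _ (interior_subset h).2
  obtain ⟨F, hF⟩ := geometric_hahn_banach_open_point hAconv.interior isOpen_interior hnot
  have hF' : ∀ p ∈ A, F p ≤ F (0, φ 0) := by
    have h1 : A ⊆ closure (interior A) := by
      rw [hAconv.closure_interior_eq_closure_of_nonempty_interior
        ⟨_, hint (Real.log v - 1) (by linarith)⟩]
      exact subset_closure
    exact fun p hp => closure_minimal (fun y hy => (hF y hy).le)
      (isClosed_le F.continuous continuous_const) (h1 hp)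
  set c : ℝ := F (0, 1) with hc
  have hFsplit : ∀ z t, F (z, t) = F (z, 0) + c * t := by
    intro z t
    have : ((z, t) : E × ℝ) = (z, 0) + t • (0, 1) := by simp
    rw [this, map_add, map_smul, smul_eq_mul, mul_comm]
  have hF0 : F ((0 : E), (0 : ℝ)) = 0 := map_zero F
  have hv0 : Real.log v ≤ φ 0 := Real.log_le_log hv (hball 0 (Metric.mem_ball_self hr))
  have hcpos : 0 < c := by
    have h := hF _ (hint (Real.log v - 1) (by linarith))
    rw [hFsplit, hFsplit 0 (φ 0)] at h
    have h' : 0 < c * (φ 0 - (Real.log v - 1)) := by linarith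
    exact pos_of_mul_pos_left h' (by linarith)
  refine ⟨-(c⁻¹ • F.comp (ContinuousLinearMap.inl ℝ E ℝ)), fun z hz => ?_⟩
  have hle : F (z, 0) + c * φ z ≤ c * φ 0 := by
    refine le_of_forall_pos_lt_add fun ε hε => ?_
    have h := hF' (z, φ z - ε / (2 * c)) ⟨hz, by simp only [sub_lt_self_iff]; positivity⟩
    rw [hFsplit, hFsplit 0 (φ 0), hF0, zero_add, mul_sub] at h
    have : c * (ε / (2 * c)) = ε / 2 := by field_simp
    linarith
  have h2 : φ z ≤ φ 0 + -(c⁻¹ * F (z, 0)) := by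
    have : φ 0 + -(c⁻¹ * F (z, 0)) = c⁻¹ * (c * φ 0 - F (z, 0)) := by field_simp; ring
    rw [this, le_inv_mul_iff₀ hcpos]
    linarith
  simpa using h2

/-- The **Milman–Pajor inequality** for a Haar measure satisfying the Prékopa–Leindler
inequality. -/
theorem Convex.measureReal_le_measureReal_inter_neg [μ.IsAddHaarMeasure] (hK : Convex ℝ K)
    (hKc : IsCompact K) (hint : (interior K).Nonempty) (hcent : ∫ x in K, x ∂μ = 0)
    (hμ : ∀ a b : ℝ, 0 < a → 0 < b → a + b = 1 → SatisfiesPrekopaLeindler μ a b) :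
    μ.real K ≤ 2 ^ Module.finrank ℝ E * μ.real (K ∩ -K) := by
  have h0 := hK.zero_mem_interior_of_setIntegral_eq_zero hKc hint hcent
  obtain ⟨L, hL⟩ := exists_log_sumDensity_le hK hKc h0 hμ
  obtain ⟨r, hr, v, hv, hball⟩ := exists_ball_le_sumDensity (μ := μ) hKc h0
  have hf0 : 0 < sumDensity μ K 0 := hv.trans_le (hball 0 (Metric.mem_ball_self hr))
  have hVpos : 0 < μ.real K := ENNReal.toReal_pos
    ((isOpen_interior.measure_pos μ hint).trans_le (measure_mono interior_subset)).ne'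
    hKc.measure_lt_top.ne
  set N : ℝ := 2 ^ Module.finrank ℝ E with hN
  have hNpos : 0 < N := by positivity
  set V := μ.real K with hV
  set m : ℝ := V / N with hm
  have hmpos : 0 < m := by positivity
  have hDc : IsCompact ((2 : ℝ) • K) := hKc.smul 2
  have hD : μ.real ((2 : ℝ) • K) = N * V := by
    rw [measureReal_def, Measure.addHaar_smul, ENNReal.toReal_mul, ENNReal.toReal_ofReal
      (abs_nonneg _), abs_of_pos hNpos]
    rfl
  have hpt : ∀ z, Real.log m * sumDensity μ K z + sumDensity μ K z
      - ((2 : ℝ) • K).indicator (fun _ => m) z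
      ≤ Real.log (sumDensity μ K 0) * sumDensity μ K z + sumDensity μ K z * L z := by
    intro z
    rcases (sumDensity_nonneg (μ := μ) (K := K) z).eq_or_lt with hz | hz
    · simp only [← hz, mul_zero, zero_mul, add_zero, zero_sub, neg_nonpos]
      exact Set.indicator_nonneg (fun _ _ => hmpos.le) z
    · have hzD : z ∈ (2 : ℝ) • K := by
        by_contra h
        exact hz.ne' (hK.sumDensity_eq_zero h)
      rw [Set.indicator_of_mem hzD]
      have h1 := mul_le_mul_of_nonneg_left (hL z hz) hz.le
      have h2 := mul_le_mul_of_nonneg_left (Real.log_le_sub_one_of_pos (div_pos hmpos hz)) hz.le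
      rw [Real.log_div hmpos.ne' hz.ne', mul_sub, mul_sub, mul_div_cancel₀ _ hz.ne'] at h2
      linarith
  have hfi := integrable_sumDensity (μ := μ) hKc
  have hfL := (integrable_sumDensity_mul_and_integral_eq (μ := μ) hKc L.continuous).1
  have hind : Integrable (((2 : ℝ) • K).indicator fun _ => m) μ :=
    (integrable_indicator_iff hDc.measurableSet).2 (integrableOn_const hDc.measure_lt_top.ne)
  have hsum : Integrable (fun z => Real.log m * sumDensity μ K z + sumDensity μ K z) μ :=
    (hfi.const_mul _).add hfi
  have hI := integral_mono (hsum.sub hind) ((hfi.const_mul _).add hfL) hpt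
  simp only [Pi.add_apply, Pi.sub_apply] at hI
  rw [integral_sub hsum hind, integral_add (hfi.const_mul _) hfi,
    integral_add (hfi.const_mul _) hfL, integral_const_mul, integral_const_mul,
    integral_sumDensity hKc, integral_sumDensity_mul_clm hKc hcent,
    integral_indicator_const _ hDc.measurableSet, hD, smul_eq_mul, ← hV] at hI
  have hmV : N * V * m = V ^ 2 := by rw [hm]; field_simp
  rw [hmV, add_sub_cancel_right, add_zero] at hI
  have hlog : Real.log m ≤ Real.log (sumDensity μ K 0) :=
    le_of_mul_le_mul_right hI (by positivity)
  have hfin := (Real.log_le_log_iff hmpos hf0).1 hlog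
  rwa [sumDensity_zero, hm, div_le_iff₀' hNpos] at hfin

end Covariogram

/-- Milman–Pajor: For a convex body `K ⊆ ℝⁿ` with `dim K = n`
whose centroid is at the origin, `vol (K ∩ (-K)) ≥ 2^{-n} vol K`. -/
theorem stmt_11 (n : ℕ) (K : Set (Fin n → ℝ)) (hKconv : Convex ℝ K)
    (hKcomp : IsCompact K) (hKdim : (interior K).Nonempty)
    (hcent : (∫ x in K, x) = (0 : Fin n → ℝ)) :
    (2 : ℝ) ^ (-(n : ℤ)) * (volume K).toReal ≤ (volume (K ∩ -K)).toReal := by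
  have h := hKconv.measureReal_le_measureReal_inter_neg hKcomp hKdim hcent
    fun a b ha hb hab => satisfiesPrekopaLeindler_pi ha hb hab n
  rw [Module.finrank_fin_fun] at h
  rw [zpow_neg, zpow_natCast, inv_mul_le_iff₀ (by positivity)]
  exact h
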